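/- In every execution of the Figure 5 algorithm, consider an Insert(x) operation ins that allocated location a (assigned m ← a) and wrote x to Items[a]. At most one successful t&s() on TS[a] by a Take operation is performed during the interval in which ins has written to Items[a] but has not yet performed its subsequent dWrite to InsertDone. -/

import Mathlib

/-!
A formal model of the algorithm of Figure 5 (a lock-free,
strongly-linearizable `b`-bounded bag with one producer and `n` consumers).

Locations `1 .. n+b` are modelled as `Fin (n+b)`.  Registers holding elements
or ⊥ are modelled as `Option ℕ` (`none` = ⊥) and test&set objects as `Bool`
(`true` = 1).  The ABA-detecting registers `InsertDone` and `TakeDone` are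
modelled by write counters (`icount`, `tcount`) together with the counter
value recorded at the last `dRead()` of each reader (`ilast i` for consumer
`i` reading `InsertDone`; `tlast` for the producer reading `TakeDone`); a
`dRead()` returns `true` iff the reader has read before and the counter has
increased since.

An execution is a list of actions (`Act`), each performing (at most) one
shared-memory access; results of accesses and nondeterministic choices are
recorded in the action.  `step` is the (partial) transition function.  The
purely local control transitions at the end of the producer's scan of `alloc`
(`insScanDone`) are modelled as separate actions.
-/

namespace Fig5

/-- Local state of the producer, besides the persistent local variables
`used` and `alloc` kept in the configuration. -/
inductive PSt (n b : ℕ) where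
  | idle : PSt n b
  /-- scanning the locations of `alloc` that are still `pending` -/
  | scan (x : ℕ) (pending : Finset (Fin (n + b))) : PSt n b
  /-- collecting `Hazards`; `i` is the next index to read -/
  | collect (x : ℕ) (i : ℕ) (hz : Finset (Fin (n + b))) : PSt n b
  /-- about to choose a fresh location and write `Allocated` -/
  | allocSt (x : ℕ) (hz : Finset (Fin (n + b))) : PSt n b
  /-- chose location `m`; resetting the test&set objects in `todo` -/
  | resets (x : ℕ) (hz : Finset (Fin (n + b))) (m : Fin (n + b))
      (todo : Finset (Fin (n + b))) : PSt n b
  /-- wrote the element, about to perform `InsertDone.dWrite()` -/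
  | dw : PSt n b
  /-- `|alloc| = b`; about to re-read `TakeDone` -/
  | recheck (x : ℕ) : PSt n b
  deriving DecidableEq

/-- Local state of a consumer. -/
inductive CSt (n b : ℕ) where
  | idle : CSt n b
  /-- about to read `Allocated` -/
  | loopStart : CSt n b
  /-- iterating over the locations read from `Allocated` that are still
      `pending` -/
  | scan (pending : Finset (Fin (n + b))) : CSt n b
  /-- about to write `a` to `Hazards[i]` -/
  | haz (pending : Finset (Fin (n + b))) (a : Fin (n + b)) : CSt n b
  /-- about to read `Items[a]` -/
  | read (pending : Finset (Fin (n + b))) (a : Fin (n + b)) : CSt n b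
  /-- read `x ≠ ⊥` from `Items[a]`, about to perform `t&s()` on `TS[a]` -/
  | tas (pending : Finset (Fin (n + b))) (a : Fin (n + b)) (x : ℕ) : CSt n b
  /-- successful `t&s`; about to write ⊥ to `Hazards[i]` -/
  | retClear (x : ℕ) : CSt n b
  /-- about to perform `TakeDone.dWrite()` and return `x` -/
  | retDone (x : ℕ) : CSt n b
  /-- about to re-read `InsertDone` -/
  | recheck : CSt n b
  /-- about to perform `TakeDone.dWrite()` and return EMPTY -/
  | emptyDone : CSt n b
  deriving DecidableEq

structure Cfg (n b : ℕ) where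
  items : Fin (n + b) → Option ℕ
  ts : Fin (n + b) → Bool
  /-- the shared register `Allocated` -/
  allocated : Finset (Fin (n + b))
  haz : Fin n → Option (Fin (n + b))
  /-- number of `dWrite()`s to `InsertDone` -/
  icount : ℕ
  /-- value of `icount` at consumer `i`'s last `dRead()` of `InsertDone` -/
  ilast : Fin n → Option ℕ
  /-- number of `dWrite()`s to `TakeDone` -/
  tcount : ℕ
  /-- value of `tcount` at the producer's last `dRead()` of `TakeDone` -/
  tlast : Option ℕ
  pst : PSt n b
  /-- the producer's persistent local variable `used` -/
  used : Finset (Fin (n + b))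
  /-- the producer's persistent local variable `alloc` -/
  palloc : Finset (Fin (n + b))
  cst : Fin n → CSt n b

inductive Act (n b : ℕ) where
  /-- the producer begins `Insert(x)` by performing `TakeDone.dRead()` -/
  | insBegin (x : ℕ) : Act n b
  /-- the producer reads `TS[m]` for the pending location `m` of its scan,
      obtaining `v`; if `v = true` it also writes ⊥ to `Items[m]`, removes `m`
      from `alloc` and adds it to `used` -/
  | insScan (m : Fin (n + b)) (v : Bool) : Act n b
  /-- local step: the scan is finished; proceed according to `|alloc| < b` -/
  | insScanDone : Act n b
  /-- the producer reads the next entry of `Hazards` -/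
  | insCollect : Act n b
  /-- the producer chooses a fresh location `m'` (not in `alloc` and not
      hazardous), adds it to `alloc` and writes `alloc` to `Allocated` -/
  | insAlloc (m' : Fin (n + b)) : Act n b
  /-- the producer resets `TS[k]` -/
  | insReset (k : Fin (n + b)) : Act n b
  /-- the producer writes its element to `Items[m]` -/
  | insWrite : Act n b
  /-- the producer performs `InsertDone.dWrite()` and returns OK -/
  | insDone : Act n b
  /-- the producer re-reads `TakeDone`, obtaining `v`; if `v = false` the
      `Insert` completes returning FULL -/
  | insRecheck (v : Bool) : Act n b
  /-- consumer `i` begins `Take()` by performing `InsertDone.dRead()` -/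
  | takeBegin (i : Fin n) : Act n b
  /-- consumer `i` reads `Allocated` -/
  | takeAlloc (i : Fin n) : Act n b
  /-- consumer `i` picks the pending location `a` and writes it to
      `Hazards[i]` -/
  | takeHaz (i : Fin n) (a : Fin (n + b)) : Act n b
  /-- consumer `i` reads `Items[a]`, obtaining `xo` -/
  | takeRead (i : Fin n) (xo : Option ℕ) : Act n b
  /-- consumer `i` performs `t&s()` on `TS[a]`; `won = true` iff successful -/
  | takeTas (i : Fin n) (won : Bool) : Act n b
  /-- consumer `i` finished its scan; it writes ⊥ to `Hazards[i]` -/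
  | takeScanEnd (i : Fin n) : Act n b
  /-- consumer `i` writes ⊥ to `Hazards[i]` after a successful `t&s` -/
  | takeRetClear (i : Fin n) : Act n b
  /-- consumer `i` performs `TakeDone.dWrite()` and returns `x` -/
  | takeRetDone (i : Fin n) (x : ℕ) : Act n b
  /-- consumer `i` re-reads `InsertDone`, obtaining `v` -/
  | takeRecheck (i : Fin n) (v : Bool) : Act n b
  /-- consumer `i` performs `TakeDone.dWrite()` and returns EMPTY -/
  | takeEmptyDone (i : Fin n) : Act n b
  deriving DecidableEq

/-- Result of an `InsertDone.dRead()` by consumer `i`. -/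
def ireadVal {n b : ℕ} (C : Cfg n b) (i : Fin n) : Bool :=
  match C.ilast i with
  | none => false
  | some c => decide (c < C.icount)

/-- Result of a `TakeDone.dRead()` by the producer. -/
def treadVal {n b : ℕ} (C : Cfg n b) : Bool :=
  match C.tlast with
  | none => false
  | some c => decide (c < C.tcount)

def step (n b : ℕ) (C : Cfg n b) : Act n b → Option (Cfg n b)
  | .insBegin x =>
      match C.pst with
      | .idle =>
          some { C with
                   tlast := some C.tcount
                   pst := .scan x C.palloc }
      | _ => none
  | .insScan m v =>
      match C.pst with
      | .scan x pending =>
          if m ∈ pending ∧ v = C.ts m then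
            if v then
              some { C with
                       items := Function.update C.items m none
                       palloc := C.palloc.erase m
                       used := insert m C.used
                       pst := .scan x (pending.erase m) }
            else
              some { C with pst := .scan x (pending.erase m) }
          else none
      | _ => none
  | .insScanDone =>
      match C.pst with
      | .scan x pending =>
          if pending = ∅ then
            if C.palloc.card < b then
              some { C with pst := if n = 0 then .allocSt x ∅ else .collect x 0 ∅ }
            else
              some { C with pst := .recheck x }
          else none
      | _ => none
  | .insCollect =>
      match C.pst with
      | .collect x i hz =>
          if h : i < n then
            let hz' := match C.haz ⟨i, h⟩ with
                       | some a => insert a hz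
                       | none => hz
            some { C with pst := if i + 1 = n then .allocSt x hz' else .collect x (i + 1) hz' }
          else none
      | _ => none
  | .insAlloc m' =>
      match C.pst with
      | .allocSt x hz =>
          if m' ∈ C.palloc ∨ m' ∈ hz then none
          else
            some { C with
                     palloc := insert m' C.palloc
                     allocated := insert m' C.palloc
                     pst := .resets x hz m' (C.used \ hz) }
      | _ => none
  | .insReset k =>
      match C.pst with
      | .resets x hz m todo =>
          if k ∈ todo then
            some { C with
                     ts := Function.update C.ts k false
                     pst := .resets x hz m (todo.erase k) }
          else none
      | _ => none
  | .insWrite =>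
      match C.pst with
      | .resets x hz m todo =>
          if todo = ∅ then
            some { C with
                     items := Function.update C.items m (some x)
                     used := C.used ∩ hz
                     pst := .dw }
          else none
      | _ => none
  | .insDone =>
      match C.pst with
      | .dw => some { C with icount := C.icount + 1, pst := .idle }
      | _ => none
  | .insRecheck v =>
      match C.pst with
      | .recheck x =>
          if v = treadVal C then
            some { C with
                     tlast := some C.tcount
                     pst := if v then .scan x C.palloc else .idle }
          else none
      | _ => none
  | .takeBegin i =>
      match C.cst i with
      | .idle =>
          some { C with
                   ilast := Function.update C.ilast i (some C.icount)
                   cst := Function.update C.cst i .loopStart }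
      | _ => none
  | .takeAlloc i =>
      match C.cst i with
      | .loopStart =>
          some { C with cst := Function.update C.cst i (.scan C.allocated) }
      | _ => none
  | .takeHaz i a =>
      match C.cst i with
      | .scan pending =>
          if a ∈ pending then
            some { C with
                     haz := Function.update C.haz i (some a)
                     cst := Function.update C.cst i (.read (pending.erase a) a) }
          else none
      | _ => none
  | .takeRead i xo =>
      match C.cst i with
      | .read pending a =>
          if xo = C.items a then
            some { C with
                     cst := Function.update C.cst i
                       (match xo with
                        | some v => .tas pending a v
                        | none => .scan pending) }
          else none
      | _ => none
  | .takeTas i won =>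
      match C.cst i with
      | .tas pending a x =>
          if won = !(C.ts a) then
            some { C with
                     ts := Function.update C.ts a true
                     cst := Function.update C.cst i
                       (if won then .retClear x else .scan pending) }
          else none
      | _ => none
  | .takeScanEnd i =>
      match C.cst i with
      | .scan pending =>
          if pending = ∅ then
            some { C with
                     haz := Function.update C.haz i none
                     cst := Function.update C.cst i .recheck }
          else none
      | _ => none
  | .takeRetClear i =>
      match C.cst i with
      | .retClear x =>
          some { C with
                   haz := Function.update C.haz i none
                   cst := Function.update C.cst i (.retDone x) }
      | _ => none
  | .takeRetDone i x =>
      match C.cst i with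
      | .retDone x' =>
          if x = x' then
            some { C with
                     tcount := C.tcount + 1
                     cst := Function.update C.cst i .idle }
          else none
      | _ => none
  | .takeRecheck i v =>
      match C.cst i with
      | .recheck =>
          if v = ireadVal C i then
            some { C with
                     ilast := Function.update C.ilast i (some C.icount)
                     cst := Function.update C.cst i (if v then .loopStart else .emptyDone) }
          else none
      | _ => none
  | .takeEmptyDone i =>
      match C.cst i with
      | .emptyDone =>
          some { C with
                   tcount := C.tcount + 1
                   cst := Function.update C.cst i .idle }
      | _ => none

def init (n b : ℕ) : Cfg n b where
  items := fun _ => none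
  ts := fun _ => false
  allocated := ∅
  haz := fun _ => none
  icount := 0
  ilast := fun _ => none
  tcount := 0
  tlast := none
  pst := .idle
  used := ∅
  palloc := ∅
  cst := fun _ => .idle

def run (n b : ℕ) : List (Act n b) → Cfg n b → Option (Cfg n b)
  | [], C => some C
  | e :: tr, C => (step n b C e).bind (run n b tr)

/-- The configuration reached after the first `t` actions of `tr`. -/
def cfgAt (n b : ℕ) (tr : List (Act n b)) (t : ℕ) : Option (Cfg n b) :=
  run n b (tr.take t) (init n b)

end Fig5

namespace Fig5

theorem run_append (n b : ℕ) (l₁ l₂ : List (Act n b)) (C : Cfg n b) :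
    run n b (l₁ ++ l₂) C = (run n b l₁ C).bind (run n b l₂) := by
  induction l₁ generalizing C with
  | nil => simp [run]
  | cons e l ih =>
    simp only [List.cons_append, run]
    cases step n b C e with
    | none => rfl
    | some D => simpa using ih D

/-- One more action: the configuration after `t+1` actions comes from a step. -/
theorem cfgAt_succ (n b : ℕ) (tr : List (Act n b)) (t : ℕ) (e : Act n b)
    (he : tr[t]? = some e) :
    cfgAt n b tr (t + 1) = (cfgAt n b tr t).bind (fun C => step n b C e) := by
  unfold cfgAt
  rw [List.take_add_one, he, run_append]
  congr 1
  funext C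
  simp [run]

/-- While the producer is about to perform `InsertDone.dWrite()`, it stays there until it
does so, and no test&set object is reset. -/
theorem step_dw (n b : ℕ) (C D : Cfg n b) (e : Act n b) (hC : C.pst = .dw)
    (he : e ≠ .insDone) (h : step n b C e = some D) :
    D.pst = .dw ∧ ∀ a, C.ts a = true → D.ts a = true := by
  cases e <;> simp only [step, hC] at h <;> try contradiction
  all_goals
    split at h <;> try contradiction
    try split at h
    all_goals try contradiction
    all_goals
      obtain rfl := Option.some.inj h
      refine ⟨rfl, fun a ha => ?_⟩
      simp [Function.update_apply, ha]

end Fig5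


/--
In every execution of the Figure 5 algorithm, consider an
`Insert(x)` operation `ins` that allocated location `a` and wrote `x` to
`Items[a]` (at position `w`, where the producer's local state records the
chosen location `a`).  At most one successful `t&s()` on `TS[a]` by a `Take`
operation is performed during the interval in which `ins` has written to
`Items[a]` but has not yet performed its subsequent `dWrite` to `InsertDone`
(i.e. at positions `u > w` such that no `insDone` action occurs in `(w, u]`).
-/
theorem fig5_at_most_one_tas_before_insertDone (n b : ℕ) (tr : List (Fig5.Act n b))
    (w : ℕ) (x : ℕ) (hz todo : Finset (Fin (n + b))) (a : Fin (n + b))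
    (Cw : Fig5.Cfg n b)
    (hCw : Fig5.cfgAt n b tr w = some Cw)
    (hw : tr[w]? = some Fig5.Act.insWrite)
    (hpst : Cw.pst = Fig5.PSt.resets x hz a todo)
    (hvalid : (Fig5.cfgAt n b tr (w + 1)).isSome)
    -- two successful t&s() on TS[a] in the interval
    (u₁ u₂ : ℕ) (h1 : w < u₁) (h12 : u₁ < u₂)
    (hno : ∀ v, w < v → v ≤ u₂ → tr[v]? ≠ some Fig5.Act.insDone)
    (i₁ i₂ : Fin n) (C₁ C₂ : Fig5.Cfg n b)
    (p₁ p₂ : Finset (Fin (n + b))) (y₁ y₂ : ℕ)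
    (hC₁ : Fig5.cfgAt n b tr u₁ = some C₁)
    (ha₁ : tr[u₁]? = some (Fig5.Act.takeTas i₁ true))
    (hs₁ : C₁.cst i₁ = Fig5.CSt.tas p₁ a y₁)
    (hv₁ : (Fig5.cfgAt n b tr (u₁ + 1)).isSome)
    (hC₂ : Fig5.cfgAt n b tr u₂ = some C₂)
    (ha₂ : tr[u₂]? = some (Fig5.Act.takeTas i₂ true))
    (hs₂ : C₂.cst i₂ = Fig5.CSt.tas p₂ a y₂)
    (hv₂ : (Fig5.cfgAt n b tr (u₂ + 1)).isSome) :
    False := by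
  have hlen : u₂ < tr.length := (List.getElem?_eq_some_iff.mp ha₂).1
  have hdw : ∀ t, w + 1 ≤ t → t ≤ u₂ → ∀ C, Fig5.cfgAt n b tr t = some C → C.pst = .dw := by
    intro t ht
    induction t, ht using Nat.le_induction with
    | base =>
      intro _ C hC
      rw [Fig5.cfgAt_succ n b tr w _ hw, hCw] at hC
      simp only [Option.bind_some, Fig5.step, hpst] at hC
      split at hC
      · obtain rfl := Option.some.inj hC
        rfl
      · contradiction
    | succ t ht ih =>
      intro htu C hC
      have hg : tr[t]? = some tr[t] := List.getElem?_eq_getElem (by omega)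
      rw [Fig5.cfgAt_succ n b tr t _ hg] at hC
      obtain ⟨B, hB, hs⟩ := Option.bind_eq_some_iff.mp hC
      exact (Fig5.step_dw n b B C _ (ih (by omega) B hB)
        (fun h => hno t (by omega) (by omega) (by rw [hg, h])) hs).1
  have hts : ∀ t, u₁ + 1 ≤ t → t ≤ u₂ → ∀ C, Fig5.cfgAt n b tr t = some C → C.ts a = true := by
    intro t ht
    induction t, ht using Nat.le_induction with
    | base =>
      intro _ C hC
      rw [Fig5.cfgAt_succ n b tr u₁ _ ha₁, hC₁] at hC
      simp only [Option.bind_some, Fig5.step, hs₁] at hC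
      split at hC
      · obtain rfl := Option.some.inj hC
        simp
      · contradiction
    | succ t ht ih =>
      intro htu C hC
      have hg : tr[t]? = some tr[t] := List.getElem?_eq_getElem (by omega)
      rw [Fig5.cfgAt_succ n b tr t _ hg] at hC
      obtain ⟨B, hB, hs⟩ := Option.bind_eq_some_iff.mp hC
      exact (Fig5.step_dw n b B C _ (hdw t (by omega) (by omega) B hB)
        (fun h => hno t (by omega) (by omega) (by rw [hg, h])) hs).2 a (ih (by omega) B hB)
  have h2 := hts u₂ h12 le_rfl C₂ hC₂
  rw [Fig5.cfgAt_succ n b tr u₂ _ ha₂, hC₂] at hv₂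
  simp [Fig5.step, hs₂, h2] at hv₂
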